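/- Let m ≥ 3 and set k = ⌊(m+1)/3⌋. In ℝ^m with standard basis vectors e_i indexed by i ∈ ZMod m, let X_m be the union, over all nonempty independent sets I of the cycle C_m (i.e., I ⊆ ZMod m containing no two cyclically consecutive elements), of the convex hulls convexHull{e_i : i ∈ I}; X_m is the geometric realization of the independence complex Ind(C_m). Then: if m = 3k+1 or m = 3k−1, X_m is homotopy equivalent to the unit sphere {x ∈ ℝ^k : ‖x‖ = 1} (a (k−1)-sphere); if m = 3k, X_m is homotopy equivalent to the union of the two unit spheres in ℝ^k centered at e_1 and at −e_1, which meet only at the origin (a model of the wedge S^{k−1} ∨ S^{k−1}). -/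

import Mathlib

/-- The geometric realization of the independence complex `Ind(C_m)` inside
`ℝ^m` (coordinates indexed by `ZMod m`): the union, over all nonempty
independent sets `I` of the cycle `C_m`, of the convex hulls of the
corresponding sets of standard basis vectors. -/
def cycleIndComplexGeom (m : ℕ) [NeZero m] : Set (EuclideanSpace ℝ (ZMod m)) :=
  ⋃ I ∈ {I : Finset (ZMod m) | I.Nonempty ∧ ∀ i ∈ I, i + 1 ∉ I},
    convexHull ℝ ((fun i : ZMod m => EuclideanSpace.single i (1 : ℝ)) '' ↑I)

/-- The first standard basis vector `e_1` of `ℝ^k`. -/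
noncomputable def firstBasisVector (k : ℕ) : EuclideanSpace ℝ (Fin k) :=
  (WithLp.equiv 2 (Fin k → ℝ)).symm (fun j => if (j : ℕ) = 0 then 1 else 0)

section Helpers
open Set

theorem mkHE {X Y : Type*} [TopologicalSpace X] [TopologicalSpace Y] (S : Set X) (T : Set Y)
    (f : X → Y) (g : Y → X) (H : ℝ × X → X) (G : ℝ × Y → Y)
    (hf : ContinuousOn f S) (hfm : ∀ x ∈ S, f x ∈ T)
    (hg : ContinuousOn g T) (hgm : ∀ y ∈ T, g y ∈ S)
    (hH : ContinuousOn H (Icc 0 1 ×ˢ S)) (hHm : ∀ t ∈ Icc (0:ℝ) 1, ∀ x ∈ S, H (t, x) ∈ S)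
    (hH0 : ∀ x ∈ S, H (0, x) = x) (hH1 : ∀ x ∈ S, H (1, x) = g (f x))
    (hG : ContinuousOn G (Icc 0 1 ×ˢ T)) (hGm : ∀ t ∈ Icc (0:ℝ) 1, ∀ x ∈ T, G (t, x) ∈ T)
    (hG0 : ∀ x ∈ T, G (0, x) = x) (hG1 : ∀ x ∈ T, G (1, x) = f (g x)) :
    Nonempty (ContinuousMap.HomotopyEquiv S T) := by
  refine ⟨⟨⟨fun x => ⟨f x, hfm x x.2⟩, ?_⟩, ⟨fun y => ⟨g y, hgm y y.2⟩, ?_⟩, ?_, ?_⟩⟩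
  · exact (continuousOn_iff_continuous_domRestrict.1 hf).subtype_mk _
  · exact (continuousOn_iff_continuous_domRestrict.1 hg).subtype_mk _
  · refine ContinuousMap.Homotopic.symm ⟨⟨⟨fun p => ⟨H (p.1, p.2), hHm _ p.1.2 _ p.2.2⟩, ?_⟩, ?_, ?_⟩⟩
    · refine Continuous.subtype_mk ?_ _
      refine hH.comp_continuous (f := fun p : unitInterval × S => ((p.1 : ℝ), (p.2 : X))) ?_ ?_
      · fun_prop
      · intro p; exact ⟨p.1.2, p.2.2⟩
    · intro x; apply Subtype.ext; exact hH0 x x.2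
    · intro x; apply Subtype.ext; exact hH1 x x.2
  · refine ContinuousMap.Homotopic.symm ⟨⟨⟨fun p => ⟨G (p.1, p.2), hGm _ p.1.2 _ p.2.2⟩, ?_⟩, ?_, ?_⟩⟩
    · refine Continuous.subtype_mk ?_ _
      refine hG.comp_continuous (f := fun p : unitInterval × T => ((p.1 : ℝ), (p.2 : Y))) ?_ ?_
      · fun_prop
      · intro p; exact ⟨p.1.2, p.2.2⟩
    · intro x; apply Subtype.ext; exact hG0 x x.2
    · intro x; apply Subtype.ext; exact hG1 x x.2

def KK (m : ℕ) (x : ℕ → ℝ) : Prop :=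
  (∀ i, 0 ≤ x i) ∧ (∀ i, m ≤ i → x i = 0) ∧ (∀ i, x i = 0 ∨ x (i+1) = 0) ∧
    (x (m-1) = 0 ∨ x 0 = 0)

def ZZ (m j : ℕ) : Set ((ℕ → ℝ) × (ℕ → ℝ)) :=
  {z | KK m z.1 ∧ (∀ i, j ≤ i → z.2 i = 0) ∧ ¬ ((∀ i, z.1 i = 0) ∧ (∀ i, z.2 i = 0))}

noncomputable def stF (n j : ℕ) (z : (ℕ → ℝ) × (ℕ → ℝ)) : (ℕ → ℝ) × (ℕ → ℝ) :=
  (fun i => if i = 0 then z.1 0 - min (z.1 0) (z.1 (n+1)) else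
    if i = n+1 then z.1 (n+1) - min (z.1 0) (z.1 (n+1)) else
    if i < n+2 then z.1 i else 0,
   fun i => if i = j then z.1 (n+3) + min (z.1 0) (z.1 (n+1)) - z.1 (n+2) - z.1 (n+4) else z.2 i)

noncomputable def stG (n j : ℕ) (z : (ℕ → ℝ) × (ℕ → ℝ)) : (ℕ → ℝ) × (ℕ → ℝ) :=
  (fun i => if i = 0 then max (z.1 0 - max (-z.2 j) 0) 0 else
    if i = n+1 then max (z.1 (n+1) - max (-z.2 j) 0) 0 else
    if i = n+2 then max (max (-z.2 j) 0 - z.1 (n+1)) 0 else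
    if i = n+3 then max (z.2 j) 0 else
    if i = n+4 then max (max (-z.2 j) 0 - z.1 0) 0 else z.1 i,
   fun i => if i = j then 0 else z.2 i)

noncomputable def stH (n : ℕ) (w : ℝ × ((ℕ → ℝ) × (ℕ → ℝ))) : (ℕ → ℝ) × (ℕ → ℝ) :=
  (fun i => if i = 0 then max (w.2.1 0 - w.1 * (min (w.2.1 0) (w.2.1 (n+1)) + w.2.1 (n+2))) 0 else
    if i = n+1 then max (w.2.1 (n+1) - w.1 * (min (w.2.1 0) (w.2.1 (n+1)) + w.2.1 (n+4))) 0 else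
    if i = n+2 then max (w.2.1 (n+2) + w.1 * w.2.1 (n+4) - w.2.1 (n+1)) 0 else
    if i = n+3 then w.2.1 (n+3) + w.1 * min (w.2.1 0) (w.2.1 (n+1)) else
    if i = n+4 then max (w.2.1 (n+4) + w.1 * w.2.1 (n+2) - w.2.1 0) 0 else w.2.1 i,
   w.2.2)

noncomputable def stK (n j : ℕ) (w : ℝ × ((ℕ → ℝ) × (ℕ → ℝ))) : (ℕ → ℝ) × (ℕ → ℝ) :=
  (fun i => if i = 0 then (1 - w.1) * w.2.1 0 + w.1 * max (w.2.1 0 - max (-w.2.2 j) 0) 0 else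
    if i = n+1 then (1 - w.1) * w.2.1 (n+1) + w.1 * max (w.2.1 (n+1) - max (-w.2.2 j) 0) 0 else w.2.1 i,
   fun i => if i = j then (1 - w.1) * w.2.2 j + w.1 * (
      max (w.2.2 j) 0 + min (max (w.2.1 0 - max (-w.2.2 j) 0) 0) (max (w.2.1 (n+1) - max (-w.2.2 j) 0) 0)
       - max (max (-w.2.2 j) 0 - w.2.1 (n+1)) 0 - max (max (-w.2.2 j) 0 - w.2.1 0) 0) else w.2.2 i)


theorem cont_ite_const {X : Type*} [TopologicalSpace X] (P : Prop) [Decidable P] {f g : X → ℝ}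
    (hf : Continuous f) (hg : Continuous g) : Continuous fun x => if P then f x else g x := by
  split_ifs <;> assumption

theorem stF_cont (n j) : Continuous (stF n j) := by
  unfold stF
  refine Continuous.prodMk (continuous_pi fun i => ?_) (continuous_pi fun i => ?_) <;>
  repeat' first | apply cont_ite_const | fun_prop
theorem stG_cont (n j) : Continuous (stG n j) := by
  unfold stG
  refine Continuous.prodMk (continuous_pi fun i => ?_) (continuous_pi fun i => ?_) <;>
  repeat' first | apply cont_ite_const | fun_prop
theorem stH_cont (n) : Continuous (stH n) := by
  unfold stH
  refine Continuous.prodMk (continuous_pi fun i => ?_) (by fun_prop)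
  repeat' first | apply cont_ite_const | fun_prop
theorem stK_cont (n j) : Continuous (stK n j) := by
  unfold stK
  refine Continuous.prodMk (continuous_pi fun i => ?_) (continuous_pi fun i => ?_) <;>
  repeat' first | apply cont_ite_const | fun_prop


theorem stF_maps (n j) (z) (hz : z ∈ ZZ (n+5) j) : stF n j z ∈ ZZ (n+2) (j+1) := by
  obtain ⟨x, y⟩ := z
  obtain ⟨⟨h0, hs, he, hl⟩, hy, hne⟩ := hz
  simp only at h0 hs he hl hy hne
  have e1 := he (n+1); have e2 := he (n+2); have e3 := he (n+3)
  simp only [add_assoc, Nat.reduceAdd] at e1 e2 e3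
  have hl' : x (n+4) = 0 ∨ x 0 = 0 := hl
  have p0 := h0 0; have p1 := h0 (n+1); have p2 := h0 (n+2); have p3 := h0 (n+3); have p4 := h0 (n+4)
  have shr : ∀ i, x i = 0 → (stF n j (x,y)).1 i = 0 := by
    intro i hi; simp only [stF]; split_ifs with h1 h2 h3
    · subst h1; rw [hi, min_eq_left (h0 _)]; simp
    · subst h2; rw [hi, min_eq_right (h0 _)]; simp
    · exact hi
    · rfl
  refine ⟨⟨?_, ?_, ?_, ?_⟩, ?_, ?_⟩
  · intro i; simp only [stF]; split_ifs <;> first | simp | exact h0 _ 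
  · intro i hi; simp only [stF]; rw [if_neg (by omega), if_neg (by omega), if_neg (by omega)]
  · intro i; exact (he i).imp (shr _) (shr _)
  · simp only [stF]; simp; clear he hs h0 hy hne shr; grind
  · intro i hi; simp only [stF]; rw [if_neg (by omega)]; exact hy _ (by omega)
  · rintro ⟨a1, a2⟩
    apply hne
    have b0 := a1 0; have b1 := a1 (n+1); have b2 := a2 j
    simp [stF] at b0 b1 b2
    have key : x 0 = 0 ∧ x (n+1) = 0 ∧ x (n+2) = 0 ∧ x (n+3) = 0 ∧ x (n+4) = 0 := by grind
    obtain ⟨k0, k1, k2, k3, k4⟩ := key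
    constructor
    · intro i
      have c := a1 i; simp only [stF] at c
      by_cases q : n + 5 ≤ i
      · exact hs i q
      clear he hs h0 shr a1 a2 hne hy hl
      by_cases q2 : i = n+2
      · rw [q2, k2]
      by_cases q3 : i = n+3
      · rw [q3, k3]
      by_cases q4 : i = n+4
      · rw [q4, k4]
      by_cases q0 : i = 0
      · rw [q0, k0]
      by_cases q1 : i = n+1
      · rw [q1, k1]
      rw [if_neg q0, if_neg q1, if_pos (by omega)] at c
      exact c
    · intro i
      have c := a2 i; simp only [stF] at c
      by_cases q : j ≤ i
      · exact hy i q
      grind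

theorem stG_maps (n j) (z) (hz : z ∈ ZZ (n+2) (j+1)) : stG n j z ∈ ZZ (n+5) j := by
  obtain ⟨x, y⟩ := z
  obtain ⟨⟨h0, hs, he, hl⟩, hy, hne⟩ := hz
  simp only at h0 hs he hl hy hne
  have hl' : x (n+1) = 0 ∨ x 0 = 0 := hl
  have p0 := h0 0; have p1 := h0 (n+1)
  have shr : ∀ i, i < n+2 → x i = 0 → (stG n j (x,y)).1 i = 0 := by
    intro i hn hi; simp only [stG]; split_ifs with h1 h2 <;> first | omega | skip
    · subst h1; rw [hi]; simp
    · subst h2; rw [hi]; simp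
  refine ⟨⟨?_, ?_, ?_, ?_⟩, ?_, ?_⟩
  · intro i; simp only [stG]; split_ifs <;> first | simp; done | exact h0 _ 
  · intro i hi; simp only [stG]; rw [if_neg (by omega), if_neg (by omega), if_neg (by omega), if_neg (by omega), if_neg (by omega)]
    exact hs _ (by omega)
  · intro i
    by_cases q : i + 1 < n + 2
    · exact (he i).imp (shr _ (by omega)) (shr _ q)
    by_cases q1 : i = n + 1
    · subst q1; simp [stG]; clear he hs h0 hy hne shr; grind
    by_cases q1 : i = n + 2
    · subst q1; simp [stG]; clear he hs h0 hy hne shr; grind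
    by_cases q1 : i = n + 3
    · subst q1; simp [stG]; clear he hs h0 hy hne shr; grind
    right
    simp only [stG]; rw [if_neg (by omega), if_neg (by omega), if_neg (by omega), if_neg (by omega), if_neg (by omega)]
    exact hs _ (by omega)
  · simp [stG]; clear he hs h0 hy hne shr; grind
  · intro i hi; simp only [stG]; split_ifs with h
    · rfl
    exact hy _ (by omega)
  · rintro ⟨a1, a2⟩
    apply hne
    have b0 := a1 0; have b1 := a1 (n+1); have b2 := a1 (n+2); have b3 := a1 (n+3); have b4 := a1 (n+4)
    simp [stG] at b0 b1 b2 b3 b4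
    have key : x 0 = 0 ∧ x (n+1) = 0 ∧ y j = 0 := by grind
    obtain ⟨k0, k1, k2⟩ := key
    constructor
    · intro i
      have c := a1 i; simp only [stG] at c
      by_cases q : n + 2 ≤ i
      · exact hs i q
      grind
    · intro i
      have c := a2 i; simp only [stG] at c
      grind

theorem aux_ab {t a b c u mn : ℝ} (hu : 0 ≤ u) (e2 : a = 0 ∨ b = 0) (e3 : b = 0 ∨ c = 0)
    (m2 : a = 0 ∨ mn = 0) (m4 : c = 0 ∨ mn = 0) : a + t * c ≤ u ∨ b + t * mn = 0 := by
  by_cases h : a = 0 ∧ c = 0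
  · left; rw [h.1, h.2]; linarith
  · right
    have hb : b = 0 := by tauto
    have hm : mn = 0 := by tauto
    rw [hb, hm]; ring

theorem stH_maps (n j) (t) (ht : t ∈ Icc (0:ℝ) 1) (z) (hz : z ∈ ZZ (n+5) j) : stH n (t, z) ∈ ZZ (n+5) j := by
  obtain ⟨x, y⟩ := z
  obtain ⟨⟨h0, hs, he, hl⟩, hy, hne⟩ := hz
  simp only at h0 hs he hl hy hne
  obtain ⟨t0, t1⟩ := ht
  have e1 := he (n+1); have e2 := he (n+2); have e3 := he (n+3)
  simp only [add_assoc, Nat.reduceAdd] at e1 e2 e3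
  have hl' : x (n+4) = 0 ∨ x 0 = 0 := hl
  have p0 := h0 0; have p1 := h0 (n+1); have p2 := h0 (n+2); have p3 := h0 (n+3); have p4 := h0 (n+4)
  have pm : 0 ≤ min (x 0) (x (n+1)) := le_min p0 p1
  have m2 : x (n+2) = 0 ∨ min (x 0) (x (n+1)) = 0 := by
    rcases e1 with h | h
    · right; rw [h]; exact min_eq_right p0
    · left; exact h
  have m4 : x (n+4) = 0 ∨ min (x 0) (x (n+1)) = 0 := by
    rcases hl' with h | h
    · left; exact h
    · right; rw [h]; exact min_eq_left p1
  have q0 : 0 ≤ t * (min (x 0) (x (n+1)) + x (n+2)) := by positivity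
  have q1 : 0 ≤ t * (min (x 0) (x (n+1)) + x (n+4)) := by positivity
  have q2 : 0 ≤ t * min (x 0) (x (n+1)) := by positivity
  have q3 : 0 ≤ t * x (n+2) := by positivity
  have q4 : 0 ≤ t * x (n+4) := by positivity
  have shr : ∀ i, i < n+2 → x i = 0 → (stH n (t, (x,y))).1 i = 0 := by
    intro i hn hi; simp only [stH]; split_ifs with h1 h2 <;> first | omega | skip
    · subst h1; apply max_eq_right; linarith
    · subst h2; apply max_eq_right; linarith
  refine ⟨⟨?_, ?_, ?_, ?_⟩, hy, ?_⟩
  · intro i; simp only [stH]; split_ifs <;> first | exact h0 _ | exact le_max_right _ _ | positivity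
  · intro i hi; simp only [stH]; rw [if_neg (by omega), if_neg (by omega), if_neg (by omega), if_neg (by omega), if_neg (by omega)]
    exact hs _ (by omega)
  · intro i
    by_cases q : i + 1 < n + 2
    · exact (he i).imp (shr _ (by omega)) (shr _ q)
    by_cases q1 : i = n + 1
    · subst q1; simp [stH]; clear he hs h0 hy hne shr; grind
    by_cases q1 : i = n + 2
    · subst q1; simp [stH]; exact aux_ab p1 e2 e3 m2 m4
    by_cases q1 : i = n + 3
    · subst q1; simp [stH]; exact (aux_ab p0 e3.symm e2.symm m4 m2).symm
    right
    simp only [stH]; rw [if_neg (by omega), if_neg (by omega), if_neg (by omega), if_neg (by omega), if_neg (by omega)]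
    exact hs _ (by omega)
  · simp [stH]; clear he hs h0 hy hne shr; grind
  · rintro ⟨a1, a2⟩
    apply hne
    have b0 := a1 0; have b1 := a1 (n+1); have b2 := a1 (n+2); have b3 := a1 (n+3); have b4 := a1 (n+4)
    simp [stH] at b0 b1 b2 b3 b4
    have key : x 0 = 0 ∧ x (n+1) = 0 ∧ x (n+2) = 0 ∧ x (n+3) = 0 ∧ x (n+4) = 0 := by
      have r3 : x (n+3) = 0 := by linarith
      have r : t * min (x 0) (x (n+1)) = 0 := by linarith
      rw [mul_add, r] at b0 b1
      have : x (n+2) = 0 := by linarith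
      have : x (n+4) = 0 := by linarith
      have z2 : t * x (n+2) = 0 := by simp [*]
      have z4 : t * x (n+4) = 0 := by simp [*]
      refine ⟨by linarith, by linarith, by assumption, by assumption, by assumption⟩
    obtain ⟨k0, k1, k2, k3, k4⟩ := key
    refine ⟨fun i => ?_, a2⟩
    have c := a1 i; simp only [stH] at c
    grind

theorem stK_maps (n j) (t) (ht : t ∈ Icc (0:ℝ) 1) (z) (hz : z ∈ ZZ (n+2) (j+1)) :
    stK n j (t, z) ∈ ZZ (n+2) (j+1) := by
  obtain ⟨x, y⟩ := z
  obtain ⟨⟨h0, hs, he, hl⟩, hy, hne⟩ := hz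
  simp only at h0 hs he hl hy hne
  obtain ⟨t0, t1⟩ := ht
  have t1' : 0 ≤ 1 - t := by linarith
  have hl' : x (n+1) = 0 ∨ x 0 = 0 := hl
  have p0 := h0 0; have p1 := h0 (n+1)
  have shr : ∀ i, x i = 0 → (stK n j (t, (x,y))).1 i = 0 := by
    intro i hi; simp only [stK]; split_ifs with h1 h2 
    · subst h1; rw [hi]; simp
    · subst h2; rw [hi]; simp
    · exact hi
  refine ⟨⟨?_, ?_, ?_, ?_⟩, ?_, ?_⟩
  · intro i; simp only [stK]; split_ifs <;> first | exact h0 _ | positivity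
  · intro i hi; exact shr i (hs i hi)
  · intro i; exact (he i).imp (shr _) (shr _)
  · exact hl'.imp (shr _) (shr _)
  · intro i hi; simp only [stK]; rw [if_neg (by omega)]; exact hy _ (by omega)
  · rintro ⟨a1, a2⟩
    apply hne
    have b0 := a1 0; have b1 := a1 (n+1); have b2 := a2 j
    simp only [stK] at b0 b1 b2
    simp only [if_true, Nat.add_eq_zero_iff, one_ne_zero, and_false, if_false] at b0 b1 b2
    have key : y j = 0 ∧ x 0 = 0 ∧ x (n+1) = 0 := by
      rcases lt_or_ge (y j) 0 with h | h
      · exfalso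
        have hh : max (y j) 0 + min (max (x 0 - max (-y j) 0) 0) (max (x (n+1) - max (-y j) 0) 0)
          - max (max (-y j) 0 - x (n+1)) 0 - max (max (-y j) 0 - x 0) 0 ≤ y j := by grind
        have := mul_le_mul_of_nonneg_left hh t0
        linarith
      · have g1 : max (-y j) 0 = 0 := by simpa using h
        have g2 : max (y j) 0 = y j := by simpa using h
        have g3 : min (x 0) (x (n+1)) = 0 := by grind
        simp [g1, g2, p0, p1, g3] at b0 b1 b2
        exact ⟨by linarith, by linarith, by linarith⟩
    obtain ⟨k0, k1, k2⟩ := key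
    constructor
    · intro i
      have c := a1 i; simp only [stK] at c
      grind
    · intro i
      have c := a2 i; simp only [stK] at c
      grind

theorem step_equiv (n j : ℕ) : Nonempty (ContinuousMap.HomotopyEquiv (ZZ (n+5) j) (ZZ (n+2) (j+1))) := by
  refine mkHE _ _ (stF n j) (stG n j) (stH n) (stK n j) (stF_cont n j).continuousOn (stF_maps n j)
    (stG_cont n j).continuousOn (stG_maps n j) (stH_cont n).continuousOn (stH_maps n j) ?_ ?_
    (stK_cont n j).continuousOn (stK_maps n j) ?_ ?_
  · rintro ⟨x, y⟩ ⟨⟨h0, hs, he, hl⟩, hy, hne⟩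
    simp only at h0 hs he hl hy hne
    have e1 := he (n+1)
    have hl' : x (n+4) = 0 ∨ x 0 = 0 := hl
    simp only [add_assoc, Nat.reduceAdd] at e1
    ext i
    · simp only [stH]
      have p0 := h0 0; have p1 := h0 (n+1); have p2 := h0 (n+2); have p3 := h0 (n+3); have p4 := h0 (n+4)
      grind
    · rfl
  · rintro ⟨x, y⟩ ⟨⟨h0, hs, he, hl⟩, hy, hne⟩
    simp only at h0 hs he hl hy hne
    have e1 := he (n+1); have e2 := he (n+2); have e3 := he (n+3)
    have hl' : x (n+4) = 0 ∨ x 0 = 0 := hl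
    simp only [add_assoc, Nat.reduceAdd] at e1 e2 e3
    have p0 := h0 0; have p1 := h0 (n+1); have p2 := h0 (n+2); have p3 := h0 (n+3); have p4 := h0 (n+4)
    ext i
    · by_cases i0 : i = 0
      · subst i0; simp [stH, stF, stG]; clear he hs h0 hy hne; grind
      by_cases i1 : i = n+1
      · subst i1; simp [stH, stF, stG]; clear he hs h0 hy hne; grind
      by_cases i2 : i = n+2
      · subst i2; simp [stH, stF, stG]; clear he hs h0 hy hne; grind
      by_cases i3 : i = n+3
      · subst i3; simp [stH, stF, stG]; clear he hs h0 hy hne; grind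
      by_cases i4 : i = n+4
      · subst i4; simp [stH, stF, stG]; clear he hs h0 hy hne; grind
      simp [stH, stF, stG, i0, i1, i2, i3, i4]
      intro; exact hs i (by omega)
    · simp only [stH, stF, stG]
      split_ifs with h
      · exact hy i (by omega)
      · rfl
  · rintro ⟨x, y⟩ ⟨⟨h0, hs, he, hl⟩, hy, hne⟩
    ext i
    · simp only [stK]; grind
    · simp only [stK]; grind
  · rintro ⟨x, y⟩ ⟨⟨h0, hs, he, hl⟩, hy, hne⟩
    simp only at h0 hs he hl hy hne
    have hl' : x (n+1) = 0 ∨ x 0 = 0 := hl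
    have p0 := h0 0; have p1 := h0 (n+1)
    ext i
    · by_cases i0 : i = 0
      · subst i0; simp [stK, stF, stG]; clear he hs h0 hy hne; grind
      by_cases i1 : i = n+1
      · subst i1; simp [stK, stF, stG]; clear he hs h0 hy hne; grind
      by_cases i2 : i < n+2
      · have : i ≠ n+2 ∧ i ≠ n+3 ∧ i ≠ n+4 := by omega
        simp [stK, stF, stG, this.1, this.2.1, this.2.2, i0, i1, i2]
      · simp [stK, stF, stG, i0, i1, i2]; exact hs i (by omega)
    · by_cases i0 : i = j
      · subst i0; simp [stK, stF, stG]
      · simp [stK, stF, stG, i0]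

theorem iter_equiv (n i : ℕ) : ∀ j, Nonempty (ContinuousMap.HomotopyEquiv (ZZ (n+2+3*i) j) (ZZ (n+2) (j+i))) := by
  induction i with
  | zero => intro j; exact ⟨ContinuousMap.HomotopyEquiv.refl _⟩
  | succ i ih =>
    intro j
    obtain ⟨e⟩ := step_equiv (n+3*i) j
    obtain ⟨e'⟩ := ih (j+1)
    have h1 : n + 2 + 3 * (i+1) = n + 3*i+5 := by ring
    have h2 : n + 2 + 3 * i = n + 3*i+2 := by ring
    have h3 : j + (i+1) = j + 1 + i := by ring
    rw [h1, h3]; rw [h2] at e'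
    exact ⟨e.trans e'⟩




theorem mem_geom (m : ℕ) [NeZero m] (x : EuclideanSpace ℝ (ZMod m)) :
    x ∈ cycleIndComplexGeom m ↔ (∀ i, 0 ≤ x i) ∧ ∑ i, x i = 1 ∧ ∀ i, x i = 0 ∨ x (i+1) = 0 := by
  simp only [cycleIndComplexGeom, mem_iUnion, mem_ofPred_eq, exists_prop]
  constructor
  · rintro ⟨I, ⟨hI, hi⟩, hx⟩
    have : x ∈ {x : EuclideanSpace ℝ (ZMod m) | (∀ i, 0 ≤ x i) ∧ ∑ i, x i = 1 ∧ ∀ i, i ∉ I → x i = 0} := by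
      refine convexHull_min ?_ ?_ hx
      · rintro _ ⟨i, hi, rfl⟩
        refine ⟨?_, ?_, ?_⟩
        · intro k; simp only [PiLp.single_apply]; split_ifs <;> norm_num
        · simp [PiLp.single_apply]
        · intro k hk; simp only [PiLp.single_apply]
          rw [if_neg]; rintro rfl; exact hk hi
      · rintro a ⟨a0, a1, a2⟩ b ⟨b0, b1, b2⟩ s t hs ht hst
        refine ⟨?_, ?_, ?_⟩
        · intro k; have := a0 k; have := b0 k; simp; positivity
        · simp [Finset.sum_add_distrib, ← Finset.mul_sum, a1, b1, hst]
        · intro k hk; simp [a2 k hk, b2 k hk]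
    obtain ⟨h0, h1, h2⟩ := this
    refine ⟨h0, h1, fun i => ?_⟩
    by_cases h : i ∈ I
    · right; exact h2 _ (hi i h)
    · left; exact h2 _ h
  · rintro ⟨h0, h1, h2⟩
    classical
    refine ⟨Finset.univ.filter (fun i => x i ≠ 0), ⟨?_, ?_⟩, ?_⟩
    · by_contra h
      rw [Finset.not_nonempty_iff_eq_empty, Finset.filter_eq_empty_iff] at h
      simp only [Finset.mem_univ, ne_eq, not_not, true_imp_iff] at h
      simp [h] at h1
    · intro i hi; simp at hi ⊢; exact (h2 i).resolve_left hi
    · have hx : x = ∑ i ∈ Finset.univ.filter (fun i => x i ≠ 0), x i • EuclideanSpace.single i (1:ℝ) := by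
        rw [Finset.sum_filter_of_ne]
        · ext k; simp [WithLp.ofLp_sum, Finset.sum_apply, Pi.single_apply]
        · intro i _ h h'; apply h; rw [h']; simp
      rw [hx]
      refine (convex_convexHull ℝ _).sum_mem (fun i _ => h0 i) ?_ ?_
      · rw [Finset.sum_filter_ne_zero]; exact h1
      · intro i hi; apply subset_convexHull; 
        refine ⟨i, ?_, rfl⟩
        rw [← hx]; exact hi

noncomputable def gP (m : ℕ) (x : EuclideanSpace ℝ (ZMod m)) : (ℕ → ℝ) × (ℕ → ℝ) :=
  (fun i => if i < m then x (i : ZMod m) else 0, fun _ => 0)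
noncomputable def gQ (m : ℕ) (z : (ℕ → ℝ) × (ℕ → ℝ)) : EuclideanSpace ℝ (ZMod m) :=
  WithLp.toLp 2 (fun k => z.1 k.val / ∑ i ∈ Finset.range m, z.1 i)

theorem sum_zmod (m : ℕ) [NeZero m] (f : ℕ → ℝ) : ∑ k : ZMod m, f k.val = ∑ i ∈ Finset.range m, f i := by
  refine Finset.sum_bij (fun k _ => k.val) ?_ ?_ ?_ ?_
  · intro k _; simp [ZMod.val_lt]
  · intro a _ b _ h; exact ZMod.val_injective m h
  · intro b hb; refine ⟨(b : ZMod m), Finset.mem_univ _, ?_⟩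
    rw [ZMod.val_natCast, Nat.mod_eq_of_lt (Finset.mem_range.1 hb)]
  · intros; rfl

theorem ZZ_sum_pos {m : ℕ} {z} (hz : z ∈ ZZ m 0) : 0 < ∑ i ∈ Finset.range m, z.1 i := by
  obtain ⟨⟨h0, hs, he, hl⟩, hy, hne⟩ := hz
  refine lt_of_le_of_ne (Finset.sum_nonneg fun i _ => h0 i) fun h => hne ⟨fun i => ?_, fun i => hy i (by omega)⟩
  rcases lt_or_ge i m with hi | hi
  · exact (Finset.sum_eq_zero_iff_of_nonneg (fun i _ => h0 i)).1 h.symm i (Finset.mem_range.2 hi)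
  · exact hs i hi

theorem geom_equiv (m : ℕ) [NeZero m] :
    Nonempty (ContinuousMap.HomotopyEquiv (cycleIndComplexGeom m) (ZZ m 0)) := by
  have hm : 0 < m := Nat.pos_of_ne_zero (NeZero.ne m)
  refine mkHE _ _ (gP m) (gQ m) (fun w => w.2)
    (fun w => (fun i => ((1 - w.1) + w.1 / ∑ i ∈ Finset.range m, w.2.1 i) * w.2.1 i, w.2.2)) ?_ ?_ ?_ ?_
    ?_ ?_ ?_ ?_ ?_ ?_ ?_ ?_
  · apply Continuous.continuousOn
    unfold gP
    refine Continuous.prodMk (continuous_pi fun i => ?_) (by fun_prop)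
    apply cont_ite_const <;> fun_prop
  · intro x hx
    rw [mem_geom] at hx
    obtain ⟨h0, h1, h2⟩ := hx
    refine ⟨⟨?_, ?_, ?_, ?_⟩, ?_, ?_⟩
    · intro i; simp only [gP]; split_ifs; exacts [h0 _, le_rfl]
    · intro i hi; simp only [gP]; rw [if_neg (by omega)]
    · intro i; simp only [gP]
      by_cases hi : i + 1 < m
      · rw [if_pos (by omega), if_pos hi]; push_cast; exact h2 i
      · right; rw [if_neg hi]
    · simp only [gP]; rw [if_pos (by omega), if_pos hm]
      have := h2 ((m-1 : ℕ) : ZMod m)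
      have e : (((m-1 : ℕ) : ZMod m) + 1) = 0 := by
        rw [← Nat.cast_one (R := ZMod m), ← Nat.cast_add, Nat.sub_add_cancel hm]; simp
      rw [e] at this
      simpa using this
    · intro i _; rfl
    · rintro ⟨a, -⟩
      have : ∀ k, x k = 0 := by
        intro k
        have := a k.val
        simp only [gP] at this
        rw [if_pos (ZMod.val_lt k)] at this
        simpa using this
      simp [this] at h1
  · unfold gQ
    refine (PiLp.continuous_toLp 2 _).comp_continuousOn ?_
    refine continuousOn_pi.2 fun k => ?_
    refine ContinuousOn.div (by fun_prop) (by fun_prop) fun z hz => (ZZ_sum_pos hz).ne'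
  · intro z hz
    have hp := ZZ_sum_pos hz
    obtain ⟨⟨h0, hs, he, hl⟩, hy, hne⟩ := hz
    rw [mem_geom]
    refine ⟨fun k => div_nonneg (h0 _) hp.le, ?_, fun k => ?_⟩
    · simp only [gQ]; rw [← Finset.sum_div, sum_zmod, div_self hp.ne']
    · have : z.1 k.val = 0 ∨ z.1 (k+1).val = 0 := by
        have hk := ZMod.val_lt k
        have e : (k + 1) = ((k.val + 1 : ℕ) : ZMod m) := by simp
        rw [e, ZMod.val_natCast]
        by_cases h : k.val + 1 < m
        · rw [Nat.mod_eq_of_lt h]; exact he _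
        · have : k.val + 1 = m := by omega
          have h' : k.val = m - 1 := by omega
          rw [this, Nat.mod_self, h']; exact hl
      simp only [gQ]
      exact this.imp (fun h => by simp [h]) (fun h => by simp [h])
  · fun_prop
  · intro t _ x hx; exact hx
  · intro x _; rfl
  · intro x hx
    rw [mem_geom] at hx
    obtain ⟨h0, h1, h2⟩ := hx
    have e : ∀ k : ZMod m, (gP m x).1 k.val = x k := by
      intro k; simp only [gP]; rw [if_pos (ZMod.val_lt k)]; simp
    ext k
    simp only [gQ]
    rw [e, ← sum_zmod]
    simp only [e]
    rw [h1]; simp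
  · refine ContinuousOn.prodMk (continuousOn_pi.2 fun i => ?_) (by fun_prop)
    refine ContinuousOn.mul (ContinuousOn.add (by fun_prop) (ContinuousOn.div (by fun_prop) (by fun_prop) ?_)) (by fun_prop)
    rintro ⟨t, z⟩ ⟨_, hz⟩
    exact (ZZ_sum_pos hz).ne'
  · rintro t ⟨t0, t1⟩ z hz
    have hp := ZZ_sum_pos hz
    obtain ⟨⟨h0, hs, he, hl⟩, hy, hne⟩ := hz
    have hc : 0 < (1 - t) + t / ∑ i ∈ Finset.range m, z.1 i := by
      rcases t0.eq_or_lt with h | h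
      · subst h; simp
      · have := div_pos h hp; linarith
    refine ⟨⟨fun i => mul_nonneg hc.le (h0 i), fun i hi => ?_, fun i => ?_, ?_⟩, hy, ?_⟩
    · simp [hs i hi]
    · exact (he i).imp (fun h => by simp [h]) (fun h => by simp [h])
    · exact hl.imp (fun h => by simp [h]) (fun h => by simp [h])
    · rintro ⟨a, b⟩
      exact hne ⟨fun i => (mul_eq_zero.1 (a i)).resolve_left hc.ne', b⟩
  · intro z _; ext i <;> simp
  · intro z hz
    obtain ⟨⟨h0, hs, he, hl⟩, hy, hne⟩ := hz
    ext i
    · simp only [gP, gQ]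
      split_ifs with h
      · rw [ZMod.val_natCast, Nat.mod_eq_of_lt h]; ring
      · rw [hs i (by omega)]; ring
    · simp only [gP]; exact hy i (by omega)


noncomputable def vv (j : ℕ) (p : ℝ) (y : ℕ → ℝ) : EuclideanSpace ℝ (Fin (j+1)) :=
  WithLp.toLp 2 (fun i => if i.val = 0 then p else y (i.val - 1))
noncomputable def tl {j : ℕ} (v : EuclideanSpace ℝ (Fin (j+1))) : ℕ → ℝ :=
  fun i => if h : i < j then v ⟨i+1, by omega⟩ else 0
noncomputable def SS (j : ℕ) (y : ℕ → ℝ) : ℝ := ∑ i ∈ Finset.range j, y i ^ 2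

theorem vv_cont (j : ℕ) : Continuous fun q : ℝ × (ℕ → ℝ) => vv j q.1 q.2 := by
  unfold vv
  refine (PiLp.continuous_toLp 2 _).comp (continuous_pi fun i => ?_)
  apply cont_ite_const <;> fun_prop
theorem tl_cont (j : ℕ) : Continuous (tl (j := j)) := by
  unfold tl
  refine continuous_pi fun i => ?_
  split_ifs <;> fun_prop
theorem SS_cont (j : ℕ) : Continuous (SS j) := by
  unfold SS; fun_prop
theorem vv_zero (j p y) : (vv j p y) 0 = p := by simp [vv]
theorem tl_vv (j p y) (hy : ∀ i, j ≤ i → y i = 0) : tl (vv j p y) = y := by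
  ext i; simp only [tl, vv]
  by_cases h : i < j
  · rw [dif_pos h, if_neg (by omega)]; simp
  · rw [dif_neg h]; exact (hy i (by omega)).symm
theorem tl_vanish (j) (v : EuclideanSpace ℝ (Fin (j+1))) : ∀ i, j ≤ i → tl v i = 0 := by
  intro i hi; simp only [tl]; rw [dif_neg (by omega)]
theorem vv_tl (j) (v : EuclideanSpace ℝ (Fin (j+1))) : vv j (v 0) (tl v) = v := by
  ext i; simp only [tl, vv]; split_ifs with h h'
  · have : i = 0 := Fin.ext h
    rw [this]
  · have : (⟨i.val - 1 + 1, by omega⟩ : Fin (j+1)) = i := by apply Fin.ext; simp; omega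
    rw [this]
  · have := i.2; omega
theorem vv_smul (j c p y) : c • vv j p y = vv j (c * p) (fun i => c * y i) := by
  ext i; simp [vv]
theorem vv_sub (j p q y) : vv j p y - vv j q (fun _ => 0) = vv j (p - q) y := by
  ext i; simp only [vv, PiLp.sub_apply]; split_ifs <;> simp
theorem vv_norm (j p y) : ‖vv j p y‖ ^ 2 = p ^ 2 + SS j y := by
  rw [EuclideanSpace.norm_sq_eq, Fin.sum_univ_succ, SS, ← Fin.sum_univ_eq_sum_range (fun i => y i ^ 2)]
  simp [vv]
theorem SS_nonneg (j y) : 0 ≤ SS j y := Finset.sum_nonneg fun _ _ => sq_nonneg _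
theorem SS_smul (j c y) : SS j (fun i => c * y i) = c ^ 2 * SS j y := by
  simp only [SS, Finset.mul_sum, mul_pow]
theorem SS_zero {j y} (h : SS j y = 0) (hy : ∀ i, j ≤ i → y i = 0) (i : ℕ) : y i = 0 := by
  rcases lt_or_ge i j with hi | hi
  · have := (Finset.sum_eq_zero_iff_of_nonneg (fun i _ => sq_nonneg (y i))).1 h i (Finset.mem_range.2 hi)
    simpa using this
  · exact hy i hi

noncomputable def sg (x : ℕ → ℝ) : ℝ := x 0 - x 1 + x 2 - x 3
noncomputable def sF (j : ℕ) (z : (ℕ → ℝ) × (ℕ → ℝ)) : EuclideanSpace ℝ (Fin (j+1)) :=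
  ‖vv j (sg z.1) z.2‖⁻¹ • vv j (sg z.1) z.2
noncomputable def sG (j : ℕ) (v : EuclideanSpace ℝ (Fin (j+1))) : (ℕ → ℝ) × (ℕ → ℝ) :=
  (fun i => if i = 0 then max (v 0) 0 else if i = 1 then max (-v 0) 0 else 0, tl v)

theorem sG_cont (j : ℕ) : Continuous (sG j) := by
  unfold sG
  refine Continuous.prodMk (continuous_pi fun i => ?_) (tl_cont j)
  repeat' first | apply cont_ite_const | fun_prop

theorem KK_alt {m : ℕ} (hm : m = 2 ∨ m = 4) (x : ℕ → ℝ) : KK m x ↔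
    (∀ i, 0 ≤ x i) ∧ (∀ i, m ≤ i → x i = 0) ∧ ((x 1 = 0 ∧ x 3 = 0) ∨ (x 0 = 0 ∧ x 2 = 0)) := by
  constructor
  · rintro ⟨h0, hs, he, hl⟩
    refine ⟨h0, hs, ?_⟩
    have e0 := he 0; have e1 := he 1; have e2 := he 2
    norm_num at e0 e1 e2
    rcases hm with rfl | rfl
    · have h2 := hs 2 (by norm_num); have h3 := hs 3 (by norm_num); tauto
    · norm_num at hl; tauto
  · rintro ⟨h0, hs, h⟩
    refine ⟨h0, hs, ?_, ?_⟩
    · intro i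
      rcases i with _ | _ | _ | _ | i
      · norm_num; tauto
      · norm_num; tauto
      · norm_num; tauto
      · right; exact hs _ (by omega)
      · right; exact hs _ (by omega)
    · rcases hm with rfl | rfl <;> norm_num <;> tauto

theorem sF_ne {m j : ℕ} (hm : m = 2 ∨ m = 4) {z} (hz : z ∈ ZZ m j) : 0 < ‖vv j (sg z.1) z.2‖ := by
  obtain ⟨hk, hy, hne⟩ := hz
  rw [KK_alt hm] at hk
  obtain ⟨h0, hs, h⟩ := hk
  by_contra hc
  have hn : ‖vv j (sg z.1) z.2‖ = 0 := le_antisymm (not_lt.1 hc) (norm_nonneg _)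
  have := vv_norm j (sg z.1) z.2
  rw [hn] at this
  have s1 := SS_nonneg j z.2
  have s2 := sq_nonneg (sg z.1)
  have s3 : sg z.1 = 0 := by
    have : sg z.1 ^ 2 = 0 := by linarith
    simpa using this
  apply hne
  refine ⟨fun i => ?_, SS_zero (by linarith) hy⟩
  have a0 := h0 0; have a1 := h0 1; have a2 := h0 2; have a3 := h0 3
  unfold sg at s3
  have hm4 : m ≤ 4 := by omega
  rcases i with _ | _ | _ | _ | i
  · norm_num; rcases h with h | h <;> linarith
  · norm_num; rcases h with h | h <;> linarith
  · norm_num; rcases h with h | h <;> linarith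
  · norm_num; rcases h with h | h <;> linarith
  · exact hs _ (by omega)

theorem sphere_equiv {m j : ℕ} (hm : m = 2 ∨ m = 4) :
    Nonempty (ContinuousMap.HomotopyEquiv (ZZ m j) (Metric.sphere (0 : EuclideanSpace ℝ (Fin (j+1))) 1)) := by
  have cF : ContinuousOn (sF j) (ZZ m j) := by
    have c1 : Continuous fun z : (ℕ → ℝ) × (ℕ → ℝ) => vv j (sg z.1) z.2 := by
      refine (vv_cont j).comp (f := fun z : (ℕ → ℝ) × (ℕ → ℝ) => (sg z.1, z.2)) ?_
      unfold sg; fun_prop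
    unfold sF
    exact ContinuousOn.smul (ContinuousOn.inv₀ c1.norm.continuousOn fun z hz => (sF_ne hm hz).ne') c1.continuousOn
  have GF : ∀ z ∈ ZZ m j, sG j (sF j z) =
    (fun i => if i = 0 then ‖vv j (sg z.1) z.2‖⁻¹ * max (sg z.1) 0 else
      if i = 1 then ‖vv j (sg z.1) z.2‖⁻¹ * max (- sg z.1) 0 else 0, fun i => ‖vv j (sg z.1) z.2‖⁻¹ * z.2 i) := by
    intro z hz
    have hc : 0 ≤ ‖vv j (sg z.1) z.2‖⁻¹ := by positivity
    simp only [sG, sF]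
    generalize ‖vv j (sg z.1) z.2‖⁻¹ = c at hc
    rw [vv_smul, tl_vv _ _ _ (fun i hi => by rw [hz.2.1 i hi, mul_zero]), vv_zero,
      mul_max_of_nonneg _ _ hc, mul_max_of_nonneg _ _ hc]
    simp
  refine mkHE _ _ (sF j) (sG j) (fun w => (1 - w.1) • w.2 + w.1 • sG j (sF j w.2)) (fun w => w.2)
    cF ?_ (sG_cont j).continuousOn ?_ ?_ ?_ ?_ ?_ ?_ ?_ ?_ ?_
  · intro z hz
    simp [sF, norm_smul, (sF_ne hm hz).ne']
  · intro v hv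
    refine ⟨?_, tl_vanish j v, ?_⟩
    · rw [KK_alt hm]
      refine ⟨?_, ?_, ?_⟩
      · intro i; simp only [sG]; split_ifs <;> simp
      · intro i hi; simp only [sG]; rw [if_neg (by omega), if_neg (by omega)]
      · simp [sG]; exact (le_total 0 (v 0)).symm.imp (fun h => by linarith) id |>.symm
    · rintro ⟨a, b⟩
      have a0 := a 0; have a1 := a 1
      simp [sG] at a0 a1 b
      have : v = 0 := by
        rw [← vv_tl j v]
        have : v 0 = 0 := le_antisymm a0 a1
        rw [this]; ext i; simp [vv, b]
      simp [this] at hv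
  · have c3 : ContinuousOn (fun w : ℝ × ((ℕ → ℝ) × (ℕ → ℝ)) => sG j (sF j w.2)) (Icc 0 1 ×ˢ ZZ m j) :=
      (sG_cont j).comp_continuousOn
        (cF.comp (f := fun w : ℝ × ((ℕ → ℝ) × (ℕ → ℝ)) => w.2) (by fun_prop) (fun w h => h.2))
    fun_prop
  · rintro t ⟨t0, t1⟩ z hz
    have hc : 0 < ‖vv j (sg z.1) z.2‖⁻¹ := inv_pos.2 (sF_ne hm hz)
    simp only [GF z hz]
    generalize ‖vv j (sg z.1) z.2‖⁻¹ = c at hc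
    obtain ⟨hk, hy, hne⟩ := hz
    rw [KK_alt hm] at hk
    obtain ⟨h0, hs, h⟩ := hk
    have a0 := h0 0; have a1 := h0 1; have a2 := h0 2; have a3 := h0 3
    have t1' : 0 ≤ 1 - t := by linarith
    have hcc : 0 < 1 - t + t * c := by
      rcases t0.eq_or_lt with h | h
      · subst h; simp
      · have := mul_pos h hc; linarith
    have hsg : (z.1 1 = 0 ∧ z.1 3 = 0 ∧ max (sg z.1) 0 = z.1 0 + z.1 2 ∧ max (-sg z.1) 0 = 0) ∨
      (z.1 0 = 0 ∧ z.1 2 = 0 ∧ max (-sg z.1) 0 = z.1 1 + z.1 3 ∧ max (sg z.1) 0 = 0) := by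
      unfold sg
      rcases h with ⟨h, h'⟩ | ⟨h, h'⟩
      · left; refine ⟨h, h', ?_, ?_⟩ <;> rw [h, h']
        · rw [max_eq_left] <;> linarith
        · rw [max_eq_right]; linarith
      · right; refine ⟨h, h', ?_, ?_⟩ <;> rw [h, h']
        · rw [max_eq_left] <;> linarith
        · rw [max_eq_right]; linarith
    refine ⟨(KK_alt hm _).2 ⟨?_, ?_, ?_⟩, ?_, ?_⟩
    · intro i
      have := h0 i
      simp only [Prod.fst_add, Prod.smul_fst, Pi.add_apply, Pi.smul_apply, smul_eq_mul]
      split_ifs <;> positivity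
    · intro i hi
      simp only [Prod.fst_add, Prod.smul_fst, Pi.add_apply, Pi.smul_apply, smul_eq_mul]
      rw [if_neg (by omega), if_neg (by omega), hs i hi]; ring
    · rcases hsg with ⟨h1, h2, h3, h4⟩ | ⟨h1, h2, h3, h4⟩
      · left; simp [h1, h2, h4]
      · right; simp [h1, h2, h4]
    · intro i hi; simp [hy i hi]
    · rintro ⟨a, b⟩
      apply hne
      constructor
      · have b0 := a 0; have b1 := a 1; have b2 := a 2; have b3 := a 3
        simp at b0 b1 b2 b3
        have key : z.1 0 = 0 ∧ z.1 1 = 0 ∧ z.1 2 = 0 ∧ z.1 3 = 0 := by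
          have key : ∀ u v : ℝ, 0 ≤ u → 0 ≤ v → (1 - t) * u + t * (c * (u + v)) = 0 →
              ((1 - t = 0) ∨ v = 0) → u = 0 ∧ v = 0 := by
            intro u v hu hv h1 h2
            have n1 : 0 ≤ t * c * v := by positivity
            have n2 : 0 ≤ (1 - t + t * c) * u := by positivity
            have n3 : (1 - t + t * c) * u = 0 := by linarith
            have n4 : t * c * v = 0 := by linarith
            have n5 := (mul_eq_zero.1 n3).resolve_left hcc.ne'
            refine ⟨n5, h2.elim (fun h => ?_) id⟩
            have : t = 1 := by linarith
            rw [this, one_mul] at n4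
            exact (mul_eq_zero.1 n4).resolve_left hc.ne'
          rcases hsg with ⟨h1, h2, h3, h4⟩ | ⟨h1, h2, h3, h4⟩
          · rw [h3] at b0
            have := key _ _ a0 a2 b0 b2
            exact ⟨this.1, h1, this.2, h2⟩
          · rw [h3] at b1
            have := key _ _ a1 a3 b1 b3
            exact ⟨h1, this.1, h2, this.2⟩
        intro i
        rcases i with _ | _ | _ | _ | i
        · exact key.1
        · exact key.2.1
        · exact key.2.2.1
        · exact key.2.2.2
        · exact hs _ (by omega)
      · intro i
        have := b i
        simp at this
        have : (1 - t + t * c) * z.2 i = 0 := by linarith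
        exact (mul_eq_zero.1 this).resolve_left hcc.ne'
  · intro z _; simp
  · intro z _; simp
  · fun_prop
  · intro t _ v hv; exact hv
  · intro v _; rfl
  · intro v hv
    have e : sg (sG j v).1 = v 0 := by
      simp [sg, sG]
    have : vv j (sg (sG j v).1) (sG j v).2 = v := by
      rw [e]; exact vv_tl j v
    simp only [sF, this]
    simp at hv
    simp [hv]




def WW (j : ℕ) : Set (EuclideanSpace ℝ (Fin (j+1))) :=
  Metric.sphere (firstBasisVector (j+1)) 1 ∪ Metric.sphere (-(firstBasisVector (j+1))) 1

theorem fbv (j : ℕ) : firstBasisVector (j+1) = vv j 1 (fun _ => 0) := by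
  ext i; simp [firstBasisVector, vv]
theorem fbv_neg (j : ℕ) : -firstBasisVector (j+1) = vv j (-1) (fun _ => 0) := by
  ext i; simp only [firstBasisVector, vv, PiLp.neg_apply]; 
  simp [WithLp.equiv]
  split_ifs <;> simp

theorem mem_sph (j p q y) : vv j p y ∈ Metric.sphere (vv j q (fun _ => 0)) 1 ↔ (p - q)^2 + SS j y = 1 := by
  rw [mem_sphere_iff_norm, vv_sub, ← vv_norm]
  constructor
  · intro h; rw [h]; norm_num
  · intro h
    have := norm_nonneg (vv j (p - q) y)
    nlinarith

theorem mem_WW (j p y) : vv j p y ∈ WW j ↔ (|p| - 1)^2 + SS j y = 1 := by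
  have hs := SS_nonneg j y
  unfold WW
  rw [fbv_neg, fbv, mem_union, mem_sph, mem_sph]
  rcases le_total 0 p with h | h
  · rw [abs_of_nonneg h]
    constructor
    · rintro (h1 | h1)
      · exact h1
      · have : p = 0 := by nlinarith
        subst this; linarith
    · intro h1; exact Or.inl h1
  · rw [abs_of_nonpos h]
    constructor
    · rintro (h1 | h1)
      · have : p = 0 := by nlinarith
        subst this; linarith
      · linarith
    · intro h1; right; linarith

theorem mem_WW' {j} {v} (h : v ∈ WW j) : (|v 0| - 1)^2 + SS j (tl v) = 1 := by
  rw [← vv_tl j v, mem_WW] at h; exact h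

theorem KK_three (x : ℕ → ℝ) : KK 3 x ↔
    (∀ i, 0 ≤ x i) ∧ (∀ i, 3 ≤ i → x i = 0) ∧ ((x 1 = 0 ∧ x 2 = 0) ∨ (x 0 = 0 ∧ x 2 = 0) ∨ (x 0 = 0 ∧ x 1 = 0)) := by
  constructor
  · rintro ⟨h0, hs, he, hl⟩
    refine ⟨h0, hs, ?_⟩
    have e0 := he 0; have e1 := he 1
    norm_num at e0 e1 hl
    tauto
  · rintro ⟨h0, hs, h⟩
    refine ⟨h0, hs, ?_, ?_⟩
    · intro i
      rcases i with _ | _ | i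
      · norm_num; tauto
      · norm_num; tauto
      · right; exact hs _ (by omega)
    · norm_num; tauto

noncomputable def DD (j : ℕ) (z : (ℕ → ℝ) × (ℕ → ℝ)) : ℝ := (z.1 0 - z.1 1)^2 + z.1 2 ^ 2 + SS j z.2

theorem DD_cont (j : ℕ) : Continuous (DD j) := by
  unfold DD; have := SS_cont j; fun_prop

theorem DD_pos {j z} (hz : z ∈ ZZ 3 j) : 0 < DD j z := by
  obtain ⟨hk, hy, hne⟩ := hz
  rw [KK_three] at hk
  obtain ⟨h0, hs, h⟩ := hk
  have s1 := SS_nonneg j z.2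
  have s2 := sq_nonneg (z.1 0 - z.1 1)
  have s3 := sq_nonneg (z.1 2)
  refine lt_of_le_of_ne (by unfold DD; linarith) fun hd => hne ?_
  unfold DD at hd
  have u1 : z.1 0 - z.1 1 = 0 := by
    have : (z.1 0 - z.1 1)^2 = 0 := by linarith
    simpa using this
  have u2 : z.1 2 = 0 := by
    have : (z.1 2)^2 = 0 := by linarith
    simpa using this
  have u3 : SS j z.2 = 0 := by linarith
  refine ⟨fun i => ?_, SS_zero u3 hy⟩
  rcases i with _ | _ | _ | i
  · norm_num; rcases h with h | h | h <;> linarith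
  · norm_num; rcases h with h | h | h <;> linarith
  · exact u2
  · exact hs _ (by omega)

noncomputable def wF (j : ℕ) (z : (ℕ → ℝ) × (ℕ → ℝ)) : EuclideanSpace ℝ (Fin (j+1)) :=
  (2 * |z.1 0 - z.1 1| / DD j z) • vv j (z.1 0 - z.1 1) z.2
noncomputable def wG (j : ℕ) (v : EuclideanSpace ℝ (Fin (j+1))) : (ℕ → ℝ) × (ℕ → ℝ) :=
  (fun i => if i = 0 then max (v 0 - 1) 0 else if i = 1 then max (-v 0 - 1) 0 else
    if i = 2 then max (1 - |v 0|) 0 else 0, tl v)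
noncomputable def wH (j : ℕ) (w : ℝ × ((ℕ → ℝ) × (ℕ → ℝ))) : (ℕ → ℝ) × (ℕ → ℝ) :=
  (fun i =>
    if i = 0 then max ((1 - w.1) * (w.2.1 0 - w.2.1 1 - w.2.1 2) +
      w.1 * (2 * |w.2.1 0 - w.2.1 1| / DD j w.2 * (w.2.1 0 - w.2.1 1) - 1)) 0 else
    if i = 1 then max ((1 - w.1) * (w.2.1 1 - w.2.1 0 - w.2.1 2) +
      w.1 * (-(2 * |w.2.1 0 - w.2.1 1| / DD j w.2 * (w.2.1 0 - w.2.1 1)) - 1)) 0 else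
    if i = 2 then max ((1 - w.1) * (w.2.1 2 - w.2.1 0 - w.2.1 1) +
      w.1 * (1 - |2 * |w.2.1 0 - w.2.1 1| / DD j w.2 * (w.2.1 0 - w.2.1 1)|)) 0 else 0,
   fun i => ((1 - w.1) + w.1 * (2 * |w.2.1 0 - w.2.1 1| / DD j w.2)) * w.2.2 i)

noncomputable def wq (p : ℝ) : ℝ := max (|p| - 1) 0
noncomputable def wr (t p : ℝ) : ℝ := (1 - t) * |p| + t * (2 * wq p ^ 2)
noncomputable def wc (t p : ℝ) : ℝ := (1 - t) + t * (2 * wq p)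
noncomputable def wN (t p S : ℝ) : ℝ := √((wr t p - 1) ^ 2 + wc t p ^ 2 * S)
noncomputable def wK (j : ℕ) (w : ℝ × EuclideanSpace ℝ (Fin (j+1))) : EuclideanSpace ℝ (Fin (j+1)) :=
  vv j (if 0 ≤ w.2 0 then 1 + (wr w.1 (w.2 0) - 1) / wN w.1 (w.2 0) (SS j (tl w.2)) else
    -(1 + (wr w.1 (w.2 0) - 1) / wN w.1 (w.2 0) (SS j (tl w.2))))
    (fun i => wc w.1 (w.2 0) / wN w.1 (w.2 0) (SS j (tl w.2)) * tl w.2 i)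

theorem wN_pos {t p S : ℝ} (t0 : 0 ≤ t) (t1 : t ≤ 1) (hS : 0 ≤ S) (h : (|p| - 1)^2 + S = 1) :
    0 < wN t p S := by
  unfold wN
  apply Real.sqrt_pos.2
  have n1 := sq_nonneg (wr t p - 1)
  have n2 : 0 ≤ wc t p ^ 2 * S := by positivity
  refine lt_of_le_of_ne (by linarith) fun h0 => ?_
  have e1 : wr t p - 1 = 0 := by
    have : (wr t p - 1)^2 = 0 := by linarith
    simpa using this
  have e2 : wc t p ^ 2 * S = 0 := by linarith
  have hp := abs_nonneg p
  unfold wr wc wq at *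
  generalize |p| = a at *
  rcases mul_eq_zero.1 e2 with h2 | h2
  · have h2 : (1 - t) + t * (2 * max (a - 1) 0) = 0 := by simpa using h2
    have hm : 0 ≤ max (a - 1) 0 := le_max_right _ _
    have h3 : 0 ≤ t * (2 * max (a - 1) 0) := by positivity
    have ht : t = 1 := by linarith
    subst ht
    have : max (a - 1) 0 = 0 := by linarith
    rw [this] at e1; norm_num at e1
  · subst h2
    have : (a - 2) * a = 0 := by linarith
    rcases mul_eq_zero.1 this with h3 | h3
    · have : a = 2 := by linarith
      subst this; norm_num at e1; linarith
    · subst h3; norm_num at e1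
theorem wN_sq {t p S : ℝ} (hS : 0 ≤ S) : wN t p S ^ 2 = (wr t p - 1) ^ 2 + wc t p ^ 2 * S := by
  unfold wN; rw [Real.sq_sqrt]; positivity


theorem wF_key {p S : ℝ} (hS : 0 ≤ S) (hp : p ≠ 0) :
    (|2 * |p| / (p^2 + S) * p| - 1)^2 + (2 * |p| / (p^2+S))^2 * S = 1 := by
  have hD : 0 < p^2 + S := by positivity
  rw [abs_mul, abs_div, abs_mul, abs_abs, abs_of_pos hD, abs_of_pos (by norm_num : (0:ℝ) < 2)]
  have h : |p| ^ 2 = p ^ 2 := sq_abs p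
  generalize |p| = a at *
  rw [← h] at hD ⊢
  have := hD.ne'
  field_simp
  ring

theorem wG_cont (j : ℕ) : Continuous (wG j) := by
  unfold wG
  refine Continuous.prodMk (continuous_pi fun i => ?_) (tl_cont j)
  repeat' first | apply cont_ite_const | fun_prop

theorem wF_mem {j z} (hz : z ∈ ZZ 3 j) : wF j z ∈ WW j := by
  unfold wF
  rw [vv_smul, mem_WW, SS_smul]
  obtain ⟨hk, hy, hne⟩ := hz
  rw [KK_three] at hk
  obtain ⟨h0, hs, h⟩ := hk
  by_cases hp : z.1 0 - z.1 1 = 0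
  · simp [hp]
  · have h2 : z.1 2 = 0 := by
      rcases h with h | h | h
      · exact h.2
      · exact h.2
      · exact absurd (by linarith) hp
    have : DD j z = (z.1 0 - z.1 1)^2 + SS j z.2 := by unfold DD; rw [h2]; ring
    rw [this]
    exact wF_key (SS_nonneg _ _) hp

theorem wG_mem {j v} (hv : v ∈ WW j) : wG j v ∈ ZZ 3 j := by
  have hw := mem_WW' hv
  refine ⟨?_, tl_vanish j v, ?_⟩
  · rw [KK_three]
    refine ⟨?_, ?_, ?_⟩
    · intro i; simp only [wG]; split_ifs <;> simp
    · intro i hi; simp only [wG]; rw [if_neg (by omega), if_neg (by omega), if_neg (by omega)]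
    · simp only [wG]; norm_num
      rcases le_total 0 (v 0) with h | h
      · rw [abs_of_nonneg h]
        rcases le_total 1 (v 0) with h1 | h1
        · left; constructor <;> linarith
        · right; right; constructor <;> linarith
      · rw [abs_of_nonpos h]
        rcases le_total (v 0) (-1) with h1 | h1
        · right; left; constructor <;> linarith
        · right; right; constructor <;> linarith
  · rintro ⟨a, b⟩
    have a0 := a 0; have a1 := a 1; have a2 := a 2
    simp [wG] at a0 a1 a2 b
    have hs : SS j (tl v) = 0 := by simp [SS, b]
    have : |v 0| ≤ 1 := abs_le.2 ⟨by linarith, by linarith⟩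
    have : |v 0| = 1 := le_antisymm this a2
    rw [this, hs] at hw; norm_num at hw

theorem wH_mem {j t z} (t0 : 0 ≤ t) (t1 : t ≤ 1) (hz : z ∈ ZZ 3 j) : wH j (t, z) ∈ ZZ 3 j := by
  have hD := DD_pos hz
  obtain ⟨hk, hy, hne⟩ := hz
  rw [KK_three] at hk
  obtain ⟨h0, hs, h⟩ := hk
  have a0 := h0 0; have a1 := h0 1; have a2 := h0 2
  have t1' : 0 ≤ 1 - t := by linarith
  have hSn := SS_nonneg j z.2
  have hDd : DD j z = (z.1 0 - z.1 1)^2 + z.1 2 ^ 2 + SS j z.2 := rfl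
  generalize hDe : DD j z = D at *
  refine ⟨?_, ?_, ?_⟩
  · rw [KK_three]
    refine ⟨?_, ?_, ?_⟩
    · intro i; simp only [wH]; split_ifs <;> simp
    · intro i hi; simp only [wH]; rw [if_neg (by omega), if_neg (by omega), if_neg (by omega)]
    · simp only [wH, hDe]
      norm_num
      rcases h with ⟨h1, h2⟩ | ⟨h1, h2⟩ | ⟨h1, h2⟩ <;> simp only [h1, h2]
      · have hP : 0 ≤ 2 * |z.1 0 - 0| / D * (z.1 0 - 0) := by rw [sub_zero]; positivity
        rw [← abs_mul, abs_of_nonneg hP]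
        generalize 2 * |z.1 0 - 0| / D * (z.1 0 - 0) = P at *
        have e1 := mul_nonneg t1' a0
        have e2 := mul_nonneg t0 hP
        rcases le_total ((1-t) * z.1 0 + t * (P - 1)) 0 with h | h
        · right; right; constructor <;> nlinarith
        · left; constructor <;> nlinarith
      · have hP : 2 * |0 - z.1 1| / D * (0 - z.1 1) ≤ 0 := by
          rw [zero_sub, mul_neg, neg_nonpos]; positivity
        rw [← abs_mul, abs_of_nonpos hP]
        generalize 2 * |0 - z.1 1| / D * (0 - z.1 1) = P at *
        have e1 := mul_nonneg t1' a1
        have e2 := mul_nonneg t0 (neg_nonneg.2 hP)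
        rcases le_total ((1-t) * z.1 1 + t * (-P - 1)) 0 with h | h
        · right; right; constructor <;> nlinarith
        · right; left; constructor <;> nlinarith
      · right; right
        have e1 := mul_nonneg t1' a2
        norm_num
        linarith
  · intro i hi; simp [wH, hy i hi]
  · rintro ⟨a, b⟩
    have b0 := a 0; have b1 := a 1; have b2 := a 2
    simp only [wH, hDe] at b0 b1 b2 b
    norm_num at b0 b1 b2
    have hc0 : 0 ≤ 2 * |z.1 0 - z.1 1| / D := by positivity
    by_cases hc : (1 - t) + t * (2 * |z.1 0 - z.1 1| / D) = 0
    · have hx : t * (2 * |z.1 0 - z.1 1| / D) = 0 := by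
        have := mul_nonneg t0 hc0; linarith
      have ht : t = 1 := by linarith
      subst ht
      rw [one_mul] at hx
      rw [hx] at b2; norm_num at b2
    · have yz : ∀ i, z.2 i = 0 := fun i => (mul_eq_zero.1 (b i)).resolve_left hc
      have hS0 : SS j z.2 = 0 := by simp [SS, yz]
      rcases h with ⟨h1, h2⟩ | ⟨h1, h2⟩ | ⟨h1, h2⟩
      · by_cases hx : z.1 0 = 0
        · rw [h1, h2, hx, hS0] at hDd; norm_num at hDd; linarith
        · have hx' : 0 < z.1 0 := lt_of_le_of_ne a0 (Ne.symm hx)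
          rw [h1, h2, hS0] at hDd
          rw [h1, h2, hDd, sub_zero, sub_zero, abs_of_pos hx'] at b0
          have : 2 * z.1 0 / (z.1 0 ^ 2 + 0 ^ 2 + 0) * z.1 0 = 2 := by field_simp; ring
          rw [this] at b0
          rcases t0.eq_or_lt with h | h
          · subst h; linarith
          · nlinarith [mul_nonneg t1' a0]
      · by_cases hx : z.1 1 = 0
        · rw [h1, h2, hx, hS0] at hDd; norm_num at hDd; linarith
        · have hx' : 0 < z.1 1 := lt_of_le_of_ne a1 (Ne.symm hx)
          rw [h1, h2, hS0] at hDd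
          rw [h1, h2, hDd, zero_sub, abs_neg, abs_of_pos hx'] at b1
          have : 2 * z.1 1 / ((-z.1 1) ^ 2 + 0 ^ 2 + 0) * -z.1 1 = -2 := by field_simp; ring
          rw [this] at b1
          rcases t0.eq_or_lt with h | h
          · subst h; linarith
          · nlinarith [mul_nonneg t1' a1]
      · rw [h1, h2] at b2; norm_num at b2
        have e1 := mul_nonneg t1' a2
        have ht : t = 0 := by nlinarith
        subst ht
        rw [h1, h2, hS0] at hDd
        have : z.1 2 = 0 := by linarith
        rw [this] at hDd; norm_num at hDd; linarith

theorem wF_cont (j : ℕ) : ContinuousOn (wF j) (ZZ 3 j) := by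
  have c1 : Continuous fun z : (ℕ → ℝ) × (ℕ → ℝ) => vv j (z.1 0 - z.1 1) z.2 :=
    (vv_cont j).comp (f := fun z : (ℕ → ℝ) × (ℕ → ℝ) => (z.1 0 - z.1 1, z.2)) (by fun_prop)
  have c2 := DD_cont j
  have c3 : ContinuousOn (fun z : (ℕ → ℝ) × (ℕ → ℝ) => 2 * |z.1 0 - z.1 1| / DD j z) (ZZ 3 j) :=
    ContinuousOn.div₀ (by fun_prop) (by fun_prop) fun z hz => (DD_pos hz).ne'
  exact c3.smul c1.continuousOn

theorem wH_cont (j : ℕ) : ContinuousOn (wH j) (Icc 0 1 ×ˢ ZZ 3 j) := by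
  have c2 := DD_cont j
  have c3 : ContinuousOn (fun w : ℝ × ((ℕ → ℝ) × (ℕ → ℝ)) => 2 * |w.2.1 0 - w.2.1 1| / DD j w.2) (Icc 0 1 ×ˢ ZZ 3 j) :=
    ContinuousOn.div₀ (by fun_prop) (by fun_prop) fun z hz => (DD_pos hz.2).ne'
  unfold wH
  refine ContinuousOn.prodMk (continuousOn_pi.2 fun i => ?_) (continuousOn_pi.2 fun i => ?_)
  · split_ifs <;> fun_prop
  · fun_prop

theorem wH_zero {j z} (hz : z ∈ ZZ 3 j) : wH j (0, z) = z := by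
  obtain ⟨hk, hy, hne⟩ := hz
  rw [KK_three] at hk
  obtain ⟨h0, hs, h⟩ := hk
  have a0 := h0 0; have a1 := h0 1; have a2 := h0 2
  refine Prod.ext ?_ ?_
  · ext i
    rcases i with _ | _ | _ | i
    · simp [wH]
      rcases h with h | h | h <;> simp [h, a0, a1, a2]
    · simp [wH]
      rcases h with h | h | h <;> simp [h, a0, a1, a2]
    · simp [wH]
      rcases h with h | h | h <;> simp [h, a0, a1, a2]
    · simp [wH]; exact (hs _ (by omega)).symm
  · ext i; simp [wH]

theorem wH_one {j z} (hz : z ∈ ZZ 3 j) : wH j (1, z) = wG j (wF j z) := by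
  unfold wH wG wF
  rw [vv_smul, vv_zero, tl_vv _ _ _ (fun i hi => by rw [hz.2.1 i hi, mul_zero])]
  simp

theorem wN_zero {p S : ℝ} (h : (|p| - 1)^2 + S = 1) : wN 0 p S = 1 := by
  unfold wN wr wc; simp [h]

theorem wN_one {p S : ℝ} (h : (|p| - 1)^2 + S = 1) : wN 1 p S = 1 := by
  unfold wN wr wc wq
  rw [Real.sqrt_eq_one]
  rcases le_total (|p| - 1) 0 with h1 | h1
  · rw [max_eq_right h1]; norm_num
  · rw [max_eq_left h1]
    have : S = 1 - (|p|-1)^2 := by linarith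
    rw [this]; ring

theorem wA_nonneg {t p S : ℝ} (hN : 0 < wN t p S) (hS : 0 ≤ S) : 0 ≤ 1 + (wr t p - 1) / wN t p S := by
  have h2 := wN_sq (t := t) (p := p) hS
  have : 0 ≤ wc t p ^ 2 * S := by positivity
  have : -wN t p S ≤ wr t p - 1 := by
    have := abs_le_of_sq_le_sq (a := wr t p - 1) (b := wN t p S) (by linarith) hN.le
    exact (abs_le.1 this).1
  have : -1 ≤ (wr t p - 1) / wN t p S := by rw [le_div_iff₀ hN]; linarith
  linarith

theorem wK_mem {j t v} (t0 : 0 ≤ t) (t1 : t ≤ 1) (hv : v ∈ WW j) : wK j (t, v) ∈ WW j := by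
  have hw := mem_WW' hv
  have hS := SS_nonneg j (tl v)
  have hN := wN_pos t0 t1 hS hw
  have hA := wA_nonneg hN hS
  have hN2 := wN_sq (t := t) (p := v 0) hS
  unfold wK
  rw [mem_WW, SS_smul]
  have : |if 0 ≤ v 0 then 1 + (wr t (v 0) - 1) / wN t (v 0) (SS j (tl v)) else
    -(1 + (wr t (v 0) - 1) / wN t (v 0) (SS j (tl v)))| = 1 + (wr t (v 0) - 1) / wN t (v 0) (SS j (tl v)) := by
    split_ifs
    · exact abs_of_nonneg hA
    · rw [abs_neg]; exact abs_of_nonneg hA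
  simp only
  rw [this]
  have hN0 := hN.ne'
  field_simp
  rw [hN2]; ring

theorem wK_zero {j v} (hv : v ∈ WW j) : wK j (0, v) = v := by
  have hw := mem_WW' hv
  unfold wK
  simp only
  rw [wN_zero hw]
  conv_rhs => rw [← vv_tl j v]
  congr 1
  · simp [wr]
    split_ifs with h
    · exact abs_of_nonneg h
    · rw [abs_of_neg (not_le.1 h)]; simp
  · ext i; simp [wc]

theorem wK_one {j v} (hv : v ∈ WW j) : wK j (1, v) = wF j (wG j v) := by
  have hw := mem_WW' hv
  have hd : DD j (wG j v) = 1 := by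
    rw [← hw]
    unfold DD wG
    simp only
    norm_num
    rcases le_total 0 (v 0) with h | h
    · rw [abs_of_nonneg h, max_eq_right (by linarith : -v 0 - 1 ≤ 0)]
      rcases le_total 1 (v 0) with h1 | h1
      · rw [max_eq_left (by linarith), max_eq_right (by linarith)]; ring
      · rw [max_eq_right (by linarith), max_eq_left (by linarith)]; ring
    · rw [abs_of_nonpos h, max_eq_right (by linarith : v 0 - 1 ≤ 0)]
      rcases le_total 1 (-v 0) with h1 | h1
      · rw [max_eq_left (by linarith), max_eq_right (by linarith)]; ring
      · rw [max_eq_right (by linarith), max_eq_left (by linarith)]; ring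
  have hq : (wG j v).1 0 - (wG j v).1 1 = if 0 ≤ v 0 then wq (v 0) else - wq (v 0) := by
    simp only [wG, wq]
    norm_num
    split_ifs with h
    · rw [abs_of_nonneg h, max_eq_right (by linarith : -v 0 - 1 ≤ 0)]; ring
    · push Not at h
      rw [abs_of_neg h, max_eq_right (by linarith : v 0 - 1 ≤ 0)]; ring
  have hq0 : 0 ≤ wq (v 0) := le_max_right _ _
  have hqa : |(wG j v).1 0 - (wG j v).1 1| = wq (v 0) := by
    rw [hq]; split_ifs <;> simp [abs_of_nonneg hq0]
  unfold wK wF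
  rw [hqa, hd, hq, vv_smul]
  simp only
  rw [wN_one hw]
  congr 1
  · unfold wr
    split_ifs <;> ring
  · ext i; simp [wc, wG]

theorem wK_cont (j : ℕ) : ContinuousOn (wK j) (Icc 0 1 ×ˢ WW j) := by
  have ct := tl_cont j
  have cS := SS_cont j
  have cN : Continuous fun w : ℝ × EuclideanSpace ℝ (Fin (j+1)) => wN w.1 (w.2 0) (SS j (tl w.2)) := by
    unfold wN wr wc wq; fun_prop
  have hN0 : ∀ w : ℝ × EuclideanSpace ℝ (Fin (j+1)), w ∈ Icc (0:ℝ) 1 ×ˢ WW j →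
    wN w.1 (w.2 0) (SS j (tl w.2)) ≠ 0 := fun w hw =>
      (wN_pos hw.1.1 hw.1.2 (SS_nonneg _ _) (mem_WW' hw.2)).ne'
  have cr : Continuous fun w : ℝ × EuclideanSpace ℝ (Fin (j+1)) => wr w.1 (w.2 0) := by
    unfold wr wq; fun_prop
  have cc : Continuous fun w : ℝ × EuclideanSpace ℝ (Fin (j+1)) => wc w.1 (w.2 0) := by
    unfold wc wq; fun_prop
  have c1 : ContinuousOn (fun w : ℝ × EuclideanSpace ℝ (Fin (j+1)) =>
      1 + (wr w.1 (w.2 0) - 1) / wN w.1 (w.2 0) (SS j (tl w.2))) (Icc 0 1 ×ˢ WW j) :=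
    continuousOn_const.add (ContinuousOn.div₀ (cr.sub continuous_const).continuousOn cN.continuousOn hN0)
  have c2 : ContinuousOn (fun w : ℝ × EuclideanSpace ℝ (Fin (j+1)) =>
      wc w.1 (w.2 0) / wN w.1 (w.2 0) (SS j (tl w.2))) (Icc 0 1 ×ˢ WW j) :=
    ContinuousOn.div₀ cc.continuousOn cN.continuousOn hN0
  unfold wK
  refine (vv_cont j).comp_continuousOn (f := fun w : ℝ × EuclideanSpace ℝ (Fin (j+1)) =>
    ((if 0 ≤ w.2 0 then 1 + (wr w.1 (w.2 0) - 1) / wN w.1 (w.2 0) (SS j (tl w.2)) else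
    -(1 + (wr w.1 (w.2 0) - 1) / wN w.1 (w.2 0) (SS j (tl w.2)))),
    (fun i => wc w.1 (w.2 0) / wN w.1 (w.2 0) (SS j (tl w.2)) * tl w.2 i)))
    (ContinuousOn.prodMk ?_ (continuousOn_pi.2 fun i => ?_))
  · rw [continuousOn_iff_continuous_domRestrict] at c1 ⊢
    refine Continuous.if_le c1 c1.neg continuous_const ?_ ?_
    · fun_prop
    · rintro ⟨⟨t, v⟩, ht, hv⟩ h
      have h : v 0 = 0 := h.symm
      have hw := mem_WW' hv
      have hS : SS j (tl v) = 0 := by rw [h] at hw; norm_num at hw; exact hw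
      have : 1 + (wr t (v 0) - 1) / wN t (v 0) (SS j (tl v)) = 0 := by
        rw [h, hS]; simp [wr, wq, wN]
      show 1 + (wr t (v 0) - 1) / wN t (v 0) (SS j (tl v)) = - (1 + (wr t (v 0) - 1) / wN t (v 0) (SS j (tl v)))
      rw [this]; simp
  · have : Continuous fun w : ℝ × EuclideanSpace ℝ (Fin (j+1)) => tl w.2 i := by fun_prop
    exact c2.mul this.continuousOn

theorem wedge_equiv (j : ℕ) : Nonempty (ContinuousMap.HomotopyEquiv (ZZ 3 j) (WW j)) :=
  mkHE _ _ (wF j) (wG j) (wH j) (wK j) (wF_cont j) (fun _ h => wF_mem h) (wG_cont j).continuousOn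
    (fun _ h => wG_mem h) (wH_cont j) (fun _ ht _ h => wH_mem ht.1 ht.2 h) (fun _ h => wH_zero h)
    (fun _ h => wH_one h) (wK_cont j) (fun _ ht _ h => wK_mem ht.1 ht.2 h) (fun _ h => wK_zero h)
    (fun _ h => wK_one h)

end Helpers

/-- **Homotopy type of `Ind(C_m)` (Proposition 2.6 / `pr:indcr`).**
For `m ≥ 3` and `k = ⌊(m+1)/3⌋`: if `m = 3k ± 1`, the geometric realization of
`Ind(C_m)` is homotopy equivalent to the unit sphere of `ℝ^k` (a `(k−1)`-sphere);
if `m = 3k`, it is homotopy equivalent to the union of the two unit spheres of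
`ℝ^k` centered at `e_1` and `−e_1` (which meet only at the origin — a model of
the wedge `S^{k−1} ∨ S^{k−1}`). -/
theorem cohomology_of_colorings_of_cycles_stmt7
    (m k : ℕ) [NeZero m] (hm : 3 ≤ m) (hk : k = (m + 1) / 3) :
    ((¬ (3 ∣ m)) → Nonempty (ContinuousMap.HomotopyEquiv (cycleIndComplexGeom m)
        (Metric.sphere (0 : EuclideanSpace ℝ (Fin k)) 1))) ∧
    ((3 ∣ m) → Nonempty (ContinuousMap.HomotopyEquiv (cycleIndComplexGeom m)
        ((Metric.sphere (firstBasisVector k) 1 ∪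
          Metric.sphere (-(firstBasisVector k)) 1 : Set (EuclideanSpace ℝ (Fin k)))))) := by
  subst hk
  have key : ∀ n i, m = n + 2 + 3 * i →
      Nonempty (ContinuousMap.HomotopyEquiv (cycleIndComplexGeom m) (ZZ (n + 2) i)) := by
    intro n i h
    obtain ⟨e1⟩ := geom_equiv m
    obtain ⟨e2⟩ := iter_equiv n i 0
    rw [zero_add, ← h] at e2
    exact ⟨e1.trans e2⟩
  constructor
  · intro h3
    have : m % 3 = 1 ∨ m % 3 = 2 := by omega
    obtain ⟨n, i, hn, h⟩ : ∃ n i, (n + 2 = 2 ∨ n + 2 = 4) ∧ m = n + 2 + 3 * i := by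
      rcases this with h | h
      · exact ⟨2, m / 3 - 1, Or.inr rfl, by omega⟩
      · exact ⟨0, m / 3, Or.inl rfl, by omega⟩
    have hk : (m + 1) / 3 = i + 1 := by omega
    rw [hk]
    obtain ⟨e1⟩ := key n i h
    obtain ⟨e2⟩ := sphere_equiv (j := i) hn
    exact ⟨e1.trans e2⟩
  · intro h3
    obtain ⟨i, h⟩ : ∃ i, m = 1 + 2 + 3 * i := ⟨m / 3 - 1, by omega⟩
    have hk : (m + 1) / 3 = i + 1 := by omega
    rw [hk]
    obtain ⟨e1⟩ := key 1 i h
    obtain ⟨e2⟩ := wedge_equiv i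
    exact ⟨e1.trans e2⟩
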